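/- Let ζ > 1, 0 < φ < π/2, a = sin φ, b = cos φ, and assume a·ζ < (1+b)/a. Then the sum of the three iterated integrals ∫_{x=(1+b)/a}^{ζ(1+b)/a} ∫_{y=(a·x·ζ−ζ²)/(x−a·ζ)}^{x·(1−b)/(1+b)} (x−y)^{−2} dy dx + ∫_{x=a·ζ}^{(1+b)/a} ∫_{y=(a·x·ζ−ζ²)/(x−a·ζ)}^{(a·x−1)/(x−a)} (x−y)^{−2} dy dx + ∫_{x=a}^{a·ζ} ∫_{y=−∞}^{(a·x−1)/(x−a)} (x−y)^{−2} dy dx equals ((1+b)/(2b))·log ζ. -/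

import Mathlib

open MeasureTheory intervalIntegral

theorem hasDerivAt_inv_const_sub {x y : ℝ} (h : y < x) :
    HasDerivAt (fun y => (x - y)⁻¹) ((x - y) ^ 2)⁻¹ y := by
  have hne : x - y ≠ 0 := (sub_pos.2 h).ne'
  refine (((hasDerivAt_id y).const_sub x).inv hne).congr_deriv ?_
  simp

theorem integral_inv_const_sub_sq {x u v : ℝ} (hu : u < x) (hv : v < x) :
    ∫ y in u..v, ((x - y) ^ 2)⁻¹ = (x - v)⁻¹ - (x - u)⁻¹ := by
  have hlt : ∀ y ∈ Set.uIcc u v, y < x := fun y hy => hy.2.trans_lt (max_lt hu hv)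
  refine integral_eq_sub_of_hasDerivAt (f := fun y => (x - y)⁻¹)
    (fun y hy => hasDerivAt_inv_const_sub (hlt y hy)) (ContinuousOn.intervalIntegrable ?_)
  exact ContinuousOn.inv₀ (by fun_prop) fun y hy => pow_ne_zero 2 (sub_pos.2 (hlt y hy)).ne'

theorem integral_Iic_inv_const_sub_sq {x v : ℝ} (hv : v < x) :
    ∫ y in Set.Iic v, ((x - y) ^ 2)⁻¹ = (x - v)⁻¹ := by
  have hflip := integral_comp_neg_Iic v (fun z : ℝ => ((x + z) ^ 2)⁻¹)
  simp only [← sub_eq_add_neg] at hflip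
  rw [hflip, integral_Ioi_of_hasDerivAt_of_nonneg' (g := fun z => -(x + z)⁻¹) (l := 0)]
  · simp [sub_eq_add_neg]
  · intro z hz
    have hne : x + z ≠ 0 := by have := Set.mem_Ici.1 hz; linarith
    refine (((hasDerivAt_id z).const_add x).inv hne).neg.congr_deriv ?_
    simp [neg_div]
  · intro z _
    positivity
  · simpa using (tendsto_inv_atTop_zero.comp
      (Filter.tendsto_atTop_add_const_left _ x Filter.tendsto_id)).neg

theorem sub_mobius_inv {a c x : ℝ} (hx : a * c < x) :
    (x - (a * x * c - c ^ 2) / (x - a * c))⁻¹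
      = (x - a * c) / (x ^ 2 - 2 * (a * c) * x + c ^ 2) := by
  have hne : x - a * c ≠ 0 := (sub_pos.2 hx).ne'
  rw [sub_div' hne, inv_div]
  congr 1
  ring

theorem quadratic_pos {a c : ℝ} (ha : a ^ 2 < 1) (hc : c ≠ 0) (x : ℝ) :
    0 < x ^ 2 - 2 * (a * c) * x + c ^ 2 := by
  have : 0 < (1 - a ^ 2) * c ^ 2 := mul_pos (by linarith) (by positivity)
  nlinarith [sq_nonneg (x - a * c)]

theorem mobius_lt {a c x : ℝ} (ha : a ^ 2 < 1) (hc : c ≠ 0) (hx : a * c < x) :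
    (a * x * c - c ^ 2) / (x - a * c) < x := by
  rw [div_lt_iff₀ (sub_pos.2 hx)]
  nlinarith [quadratic_pos ha hc x]

theorem intervalIntegrable_logDeriv_quadratic {a c : ℝ} (ha : a ^ 2 < 1) (hc : c ≠ 0) (u v : ℝ) :
    IntervalIntegrable (fun x => (x - a * c) / (x ^ 2 - 2 * (a * c) * x + c ^ 2)) volume u v :=
  (Continuous.div (by fun_prop) (by fun_prop)
    fun x => (quadratic_pos ha hc x).ne').intervalIntegrable _ _

theorem integral_logDeriv_quadratic {a c : ℝ} (ha : a ^ 2 < 1) (hc : c ≠ 0) (u v : ℝ) :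
    ∫ x in u..v, (x - a * c) / (x ^ 2 - 2 * (a * c) * x + c ^ 2)
      = Real.log (v ^ 2 - 2 * (a * c) * v + c ^ 2) / 2
        - Real.log (u ^ 2 - 2 * (a * c) * u + c ^ 2) / 2 := by
  refine integral_eq_sub_of_hasDerivAt
    (f := fun x => Real.log (x ^ 2 - 2 * (a * c) * x + c ^ 2) / 2) (fun x _ => ?_)
    (intervalIntegrable_logDeriv_quadratic ha hc u v)
  have hne := (quadratic_pos ha hc x).ne'
  have hd : HasDerivAt (fun x : ℝ => x ^ 2 - 2 * (a * c) * x + c ^ 2)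
      (2 * x - 2 * (a * c)) x := by
    simpa using (((hasDerivAt_pow 2 x).sub
      ((hasDerivAt_id x).const_mul (2 * (a * c)))).add_const (c ^ 2))
  refine ((hd.log hne).div_const 2).congr_deriv ?_
  field_simp

/-- Let ζ > 1, 0 < φ < π/2, a = sin φ, b = cos φ, and assume a·ζ < (1+b)/a. Then the sum
of the three iterated integrals M₁ + M₂ + M₃ equals ((1+b)/(2b))·log ζ. -/
theorem stmt14 (ζ φ a b : ℝ) (hζ : 1 < ζ) (h1 : 0 < φ) (h2 : φ < Real.pi / 2)
    (ha : a = Real.sin φ) (hb : b = Real.cos φ) (hlt : a * ζ < (1 + b) / a) :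
    (∫ x in ((1 + b) / a)..(ζ * (1 + b) / a),
        (∫ y in ((a * x * ζ - ζ ^ 2) / (x - a * ζ))..(x * (1 - b) / (1 + b)), ((x - y) ^ 2)⁻¹))
    + (∫ x in (a * ζ)..((1 + b) / a),
        (∫ y in ((a * x * ζ - ζ ^ 2) / (x - a * ζ))..((a * x - 1) / (x - a)), ((x - y) ^ 2)⁻¹))
    + (∫ x in a..(a * ζ), (∫ y in Set.Iic ((a * x - 1) / (x - a)), ((x - y) ^ 2)⁻¹))
    = (1 + b) / (2 * b) * Real.log ζ := by
  have hb0 : 0 < b := hb ▸ Real.cos_pos_of_mem_Ioo ⟨by linarith, h2⟩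
  have ha0 : 0 < a := ha ▸ Real.sin_pos_of_pos_of_lt_pi h1 (by linarith)
  have hab : a ^ 2 + b ^ 2 = 1 := by rw [ha, hb, Real.sin_sq_add_cos_sq]
  have ha1 : a ^ 2 < 1 := by nlinarith [pow_pos hb0 2]
  have hζ0 : 0 < ζ := one_pos.trans hζ
  have haζ : a < a * ζ := lt_mul_of_one_lt_right ha0 hζ
  have hp0 : 0 < (1 + b) / a := by positivity
  have hp : (1 + b) / a < ζ * (1 + b) / a := by
    rw [mul_div_assoc]
    exact lt_mul_of_one_lt_left hp0 hζ
  set P : ℝ → ℝ → ℝ := fun c x => (x - a * c) / (x ^ 2 - 2 * (a * c) * x + c ^ 2) with hP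
  have hPint : ∀ c, c ≠ 0 → ∀ u v, IntervalIntegrable (P c) volume u v :=
    fun c hc u v => intervalIntegrable_logDeriv_quadratic ha1 hc u v
  have hone : ∀ x, a < x → (a * x - 1) / (x - a) < x ∧
      (x - (a * x - 1) / (x - a))⁻¹ = P 1 x := fun x hx =>
    ⟨by simpa using mobius_lt (c := 1) ha1 one_ne_zero (by simpa using hx),
      by simpa [hP] using sub_mobius_inv (a := a) (c := 1) (x := x) (by simpa using hx)⟩
  have hM₁ : (∫ x in ((1 + b) / a)..(ζ * (1 + b) / a),
        (∫ y in ((a * x * ζ - ζ ^ 2) / (x - a * ζ))..(x * (1 - b) / (1 + b)), ((x - y) ^ 2)⁻¹))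
      = ∫ x in ((1 + b) / a)..(ζ * (1 + b) / a), ((1 + b) / (2 * b) * x⁻¹ - P ζ x) := by
    refine integral_congr_Ioo_of_le hp.le fun x hx => ?_
    have hxζ : a * ζ < x := hlt.trans hx.1
    have hx0 : 0 < x := hp0.trans hx.1
    have hdiff : x - x * (1 - b) / (1 + b) = 2 * b * x / (1 + b) := by field_simp; ring
    have hylt : x * (1 - b) / (1 + b) < x := by
      rw [← sub_pos, hdiff]
      positivity
    rw [integral_inv_const_sub_sq (mobius_lt ha1 hζ0.ne' hxζ) hylt, sub_mobius_inv hxζ, hdiff]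
    simp only [hP]
    congr 1
    field_simp
  have hM₂ : (∫ x in (a * ζ)..((1 + b) / a),
        (∫ y in ((a * x * ζ - ζ ^ 2) / (x - a * ζ))..((a * x - 1) / (x - a)), ((x - y) ^ 2)⁻¹))
      = ∫ x in (a * ζ)..((1 + b) / a), (P 1 x - P ζ x) := by
    refine integral_congr_Ioo_of_le hlt.le fun x hx => ?_
    obtain ⟨hylt, hinv⟩ := hone x (haζ.trans hx.1)
    rw [integral_inv_const_sub_sq (mobius_lt ha1 hζ0.ne' hx.1) hylt, sub_mobius_inv hx.1, hinv]
  have hM₃ : (∫ x in a..(a * ζ), (∫ y in Set.Iic ((a * x - 1) / (x - a)), ((x - y) ^ 2)⁻¹))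
      = ∫ x in a..(a * ζ), P 1 x := by
    refine integral_congr_Ioo_of_le haζ.le fun x hx => ?_
    obtain ⟨hylt, hinv⟩ := hone x hx.1
    rw [integral_Iic_inv_const_sub_sq hylt, hinv]
  have hinvint : IntervalIntegrable (fun x : ℝ => (1 + b) / (2 * b) * x⁻¹) volume
      ((1 + b) / a) (ζ * (1 + b) / a) := by
    refine (intervalIntegrable_inv (fun x hx => ?_) continuousOn_id).const_mul _
    rw [Set.uIcc_of_le hp.le] at hx
    exact (hp0.trans_le hx.1).ne'
  have hscale : ∀ x, Real.log ((ζ * x) ^ 2 - 2 * (a * ζ) * (ζ * x) + ζ ^ 2)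
      = Real.log (ζ ^ 2) + Real.log (x ^ 2 - 2 * (a * 1) * x + 1 ^ 2) := fun x => by
    rw [← Real.log_mul (by positivity) (quadratic_pos ha1 one_ne_zero x).ne']
    ring_nf
  have hratio : ζ * (1 + b) / a / ((1 + b) / a) = ζ := by field_simp
  rw [hM₁, hM₂, hM₃, integral_sub hinvint (hPint ζ hζ0.ne' _ _),
    integral_sub (hPint 1 one_ne_zero _ _) (hPint ζ hζ0.ne' _ _),
    intervalIntegral.integral_const_mul, integral_inv_of_pos hp0 (hp0.trans hp), hratio]
  simp only [hP, integral_logDeriv_quadratic ha1 hζ0.ne',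
    integral_logDeriv_quadratic ha1 one_ne_zero]
  have hleft := hscale a
  rw [mul_comm ζ a] at hleft
  rw [mul_div_assoc, hscale, hleft]
  ring
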